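/- (Key-entropy bound from reliability and secrecy.) Let S, B, A, E be discrete random variables with finite ranges on a common probability space, let 0 ≤ δ < 1/2, and suppose: (i) S is a deterministic function of B; (ii) H(S | A) ≤ h(δ) + δ·H(S), where h(δ) = −δ·log₂ δ − (1−δ)·log₂(1−δ) is the binary entropy function; and (iii) I(S; E) ≤ δ·H(S). Then H(S) ≤ (I(B; A | E) + h(δ)) / (1 − 2δ). -/

import Mathlib

open scoped BigOperators Classical

noncomputable section

/-- `μ` is a probability mass function on the finite sample space `Ω`. -/
def IsProb {Ω : Type*} [Fintype Ω] (μ : Ω → ℝ) : Prop :=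
  (∀ ω, 0 ≤ μ ω) ∧ ∑ ω, μ ω = 1

/-- The probability that the discrete random variable `X` takes the value `a`. -/
def pr {Ω : Type*} [Fintype Ω] (μ : Ω → ℝ) {α : Type*} (X : Ω → α) (a : α) : ℝ :=
  ∑ ω ∈ Finset.univ.filter (fun ω => X ω = a), μ ω

/-- Shannon entropy (in bits) of a discrete random variable with finite range. -/
def H {Ω : Type*} [Fintype Ω] (μ : Ω → ℝ) {α : Type*} [Fintype α] (X : Ω → α) : ℝ :=
  -∑ a : α, pr μ X a * Real.logb 2 (pr μ X a)

/-- Conditional entropy `H(X | Y) = H(X, Y) − H(Y)` (in bits). -/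
def condH {Ω : Type*} [Fintype Ω] (μ : Ω → ℝ) {α β : Type*} [Fintype α] [Fintype β]
    (X : Ω → α) (Y : Ω → β) : ℝ :=
  H μ (fun ω => (X ω, Y ω)) - H μ Y

/-- Mutual information `I(X; Y) = H(X) + H(Y) − H(X, Y)` (in bits). -/
def MI {Ω : Type*} [Fintype Ω] (μ : Ω → ℝ) {α β : Type*} [Fintype α] [Fintype β]
    (X : Ω → α) (Y : Ω → β) : ℝ :=
  H μ X + H μ Y - H μ (fun ω => (X ω, Y ω))

/-- Conditional mutual information
`I(X; Y | Z) = H(X, Z) + H(Y, Z) − H(X, Y, Z) − H(Z)` (in bits). -/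
def CMI {Ω : Type*} [Fintype Ω] (μ : Ω → ℝ) {α β γ : Type*} [Fintype α] [Fintype β] [Fintype γ]
    (X : Ω → α) (Y : Ω → β) (Z : Ω → γ) : ℝ :=
  H μ (fun ω => (X ω, Z ω)) + H μ (fun ω => (Y ω, Z ω)) -
    H μ (fun ω => (X ω, Y ω, Z ω)) - H μ Z

/-- `X` and `Y` are conditionally independent given `Z`:
`P(X = a, Y = b, Z = c) · P(Z = c) = P(X = a, Z = c) · P(Y = b, Z = c)` for all `a, b, c`. -/
def CondIndep {Ω : Type*} [Fintype Ω] (μ : Ω → ℝ) {α β γ : Type*}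
    (X : Ω → α) (Y : Ω → β) (Z : Ω → γ) : Prop :=
  ∀ a b c, pr μ (fun ω => (X ω, Y ω, Z ω)) (a, b, c) * pr μ Z c =
    pr μ (fun ω => (X ω, Z ω)) (a, c) * pr μ (fun ω => (Y ω, Z ω)) (b, c)

/-- `X` and `Y` are independent: `P(X = a, Y = b) = P(X = a) · P(Y = b)` for all `a, b`. -/
def Indep {Ω : Type*} [Fintype Ω] (μ : Ω → ℝ) {α β : Type*}
    (X : Ω → α) (Y : Ω → β) : Prop :=
  ∀ a b, pr μ (fun ω => (X ω, Y ω)) (a, b) = pr μ X a * pr μ Y b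

/-- The binary entropy function `h(δ) = −δ·log₂ δ − (1−δ)·log₂(1−δ)`. -/
def binEnt (δ : ℝ) : ℝ :=
  -(δ * Real.logb 2 δ) - (1 - δ) * Real.logb 2 (1 - δ)

theorem sum_pr {Ω : Type*} [Fintype Ω] (μ : Ω → ℝ) {α : Type*} [Fintype α] (X : Ω → α)
    (F : α → ℝ) : ∑ a, pr μ X a * F a = ∑ ω, μ ω * F (X ω) := by
  unfold pr
  simp_rw [Finset.sum_mul, Finset.sum_filter]
  rw [Finset.sum_comm]
  refine Finset.sum_congr rfl fun ω _ => ?_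
  simp

theorem H_eq {Ω : Type*} [Fintype Ω] (μ : Ω → ℝ) {α : Type*} [Fintype α] (X : Ω → α) :
    H μ X = -∑ ω, μ ω * Real.logb 2 (pr μ X (X ω)) := by
  unfold H
  rw [sum_pr μ X (fun a => Real.logb 2 (pr μ X a))]

theorem H_congr {Ω : Type*} [Fintype Ω] (μ : Ω → ℝ) {α β : Type*} [Fintype α] [Fintype β]
    (X : Ω → α) (Y : Ω → β) (h : ∀ ω ω', X ω' = X ω ↔ Y ω' = Y ω) : H μ X = H μ Y := by
  rw [H_eq, H_eq]
  unfold pr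
  simp_rw [h]

theorem pr_nonneg {Ω : Type*} [Fintype Ω] (μ : Ω → ℝ) (hμ : IsProb μ) {α : Type*}
    (X : Ω → α) (a : α) : 0 ≤ pr μ X a :=
  Finset.sum_nonneg fun ω _ => hμ.1 ω

theorem pr_pos {Ω : Type*} [Fintype Ω] (μ : Ω → ℝ) (hμ : IsProb μ) {α : Type*}
    (X : Ω → α) (ω : Ω) (h : 0 < μ ω) : 0 < pr μ X (X ω) :=
  lt_of_lt_of_le h
    (Finset.single_le_sum (f := μ) (fun ω _ => hμ.1 ω) (by simp))

theorem sum_marg {Ω : Type*} [Fintype Ω] (μ : Ω → ℝ) {α γ : Type*} [Fintype α]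
    (X : Ω → α) (Z : Ω → γ) (c : γ) :
    ∑ a, pr μ (fun ω => (X ω, Z ω)) (a, c) = pr μ Z c := by
  unfold pr
  simp_rw [Finset.sum_filter, Prod.mk.injEq]
  rw [Finset.sum_comm]
  refine Finset.sum_congr rfl fun ω _ => ?_
  by_cases h : Z ω = c <;> simp [h]

theorem CMI_nonneg {Ω : Type*} [Fintype Ω] (μ : Ω → ℝ) (hμ : IsProb μ)
    {α β γ : Type*} [Fintype α] [Fintype β] [Fintype γ]
    (X : Ω → α) (Y : Ω → β) (Z : Ω → γ) : 0 ≤ CMI μ X Y Z := by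
  unfold CMI
  simp only [H_eq]
  set P := pr μ (fun ω => (X ω, Z ω)) with hP
  set Q := pr μ (fun ω => (Y ω, Z ω)) with hQ
  set T := pr μ (fun ω => (X ω, Y ω, Z ω)) with hT
  set R := pr μ Z with hR
  let F : α × β × γ → ℝ := fun t => P (t.1, t.2.2) * Q (t.2.1, t.2.2) / (T t * R t.2.2)
  have hPn : ∀ a, 0 ≤ P a := pr_nonneg μ hμ _
  have hQn : ∀ a, 0 ≤ Q a := pr_nonneg μ hμ _
  have hTn : ∀ a, 0 ≤ T a := pr_nonneg μ hμ _
  have hRn : ∀ a, 0 ≤ R a := pr_nonneg μ hμ _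
  have h1 : ∑ ω, μ ω * F (X ω, Y ω, Z ω) ≤ 1 := by
    rw [← sum_pr μ (fun ω => (X ω, Y ω, Z ω)) F]
    calc _ ≤ ∑ t : α × β × γ, P (t.1, t.2.2) * Q (t.2.1, t.2.2) / R t.2.2 := by
          refine Finset.sum_le_sum fun t _ => ?_
          change T t * (P (t.1, t.2.2) * Q (t.2.1, t.2.2) / (T t * R t.2.2)) ≤ _
          rcases (hTn t).eq_or_lt with h | h
          · rw [← h, zero_mul]
            exact div_nonneg (mul_nonneg (hPn _) (hQn _)) (hRn _)
          · rw [mul_div_assoc', mul_div_mul_left _ _ h.ne']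
      _ = ∑ c, (∑ a, P (a, c)) * (∑ b, Q (b, c)) / R c := by
          simp_rw [Fintype.sum_prod_type, Finset.sum_mul_sum, Finset.sum_div]
          rw [Finset.sum_comm (s := (Finset.univ : Finset γ))]
          refine Finset.sum_congr rfl fun a _ => ?_
          rw [Finset.sum_comm]
      _ = ∑ c, R c * 1 := by
          refine Finset.sum_congr rfl fun c _ => ?_
          rw [hP, hQ, sum_marg, sum_marg, ← hR]
          simp
      _ = 1 := by
          rw [hR, sum_pr μ Z (fun _ => 1)]
          simpa using hμ.2
  have h2 : ∀ ω, μ ω * Real.logb 2 (P (X ω, Z ω)) + μ ω * Real.logb 2 (Q (Y ω, Z ω))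
      - μ ω * Real.logb 2 (T (X ω, Y ω, Z ω)) - μ ω * Real.logb 2 (R (Z ω))
      ≤ (μ ω * F (X ω, Y ω, Z ω) - μ ω) / Real.log 2 := by
    intro ω
    rcases (hμ.1 ω).eq_or_lt with h | h
    · simp [← h]
    · have p1 : 0 < P (X ω, Z ω) := pr_pos μ hμ (fun ω => (X ω, Z ω)) ω h
      have p2 : 0 < Q (Y ω, Z ω) := pr_pos μ hμ (fun ω => (Y ω, Z ω)) ω h
      have p3 : 0 < T (X ω, Y ω, Z ω) := pr_pos μ hμ (fun ω => (X ω, Y ω, Z ω)) ω h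
      have p4 : 0 < R (Z ω) := pr_pos μ hμ Z ω h
      have hF : 0 < F (X ω, Y ω, Z ω) := div_pos (mul_pos p1 p2) (mul_pos p3 p4)
      have hl := Real.log_le_sub_one_of_pos hF
      have e : Real.log (F (X ω, Y ω, Z ω)) = Real.log (P (X ω, Z ω)) + Real.log (Q (Y ω, Z ω))
          - (Real.log (T (X ω, Y ω, Z ω)) + Real.log (R (Z ω))) := by
        change Real.log (_ / _) = _
        rw [Real.log_div (mul_pos p1 p2).ne' (mul_pos p3 p4).ne', Real.log_mul p1.ne' p2.ne',
          Real.log_mul p3.ne' p4.ne']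
      have l2 : 0 < Real.log 2 := Real.log_pos (by norm_num)
      have : μ ω * Real.log (F (X ω, Y ω, Z ω)) ≤ μ ω * (F (X ω, Y ω, Z ω) - 1) :=
        mul_le_mul_of_nonneg_left hl h.le
      rw [e] at this
      rw [le_div_iff₀ l2]
      unfold Real.logb
      field_simp
      linarith
  have h3 := Finset.sum_le_sum (s := Finset.univ) fun ω _ => h2 ω
  rw [← Finset.sum_div, Finset.sum_sub_distrib, Finset.sum_sub_distrib, Finset.sum_sub_distrib,
    Finset.sum_add_distrib, hμ.2] at h3
  have h4 : (∑ ω, μ ω * F (X ω, Y ω, Z ω) - 1) / Real.log 2 ≤ 0 :=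
    div_nonpos_of_nonpos_of_nonneg (by linarith) (Real.log_nonneg (by norm_num))
  linarith

/-- Key-entropy bound from reliability and secrecy: if `S` is a deterministic function of `B`,
`H(S | A) ≤ h(δ) + δ·H(S)` and `I(S; E) ≤ δ·H(S)` for `0 ≤ δ < 1/2`, then
`H(S) ≤ (I(B; A | E) + h(δ)) / (1 − 2δ)`. -/
theorem key_entropy_bound {Ω : Type*} [Fintype Ω] (μ : Ω → ℝ) (hμ : IsProb μ)
    {αS αB αA αE : Type*} [Fintype αS] [Fintype αB] [Fintype αA] [Fintype αE]
    (S : Ω → αS) (B : Ω → αB) (A : Ω → αA) (E : Ω → αE)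
    (δ : ℝ) (hδ0 : 0 ≤ δ) (hδ1 : δ < 1 / 2)
    (hdet : ∃ f : αB → αS, ∀ ω, S ω = f (B ω))
    (hrel : condH μ S A ≤ binEnt δ + δ * H μ S)
    (hsec : MI μ S E ≤ δ * H μ S) :
    H μ S ≤ (CMI μ B A E + binEnt δ) / (1 - 2 * δ) := by
  obtain ⟨f, hf⟩ := hdet
  have c1 := CMI_nonneg μ hμ S E A
  have c2 := CMI_nonneg μ hμ B A (fun ω => (S ω, E ω))
  have e1 : H μ (fun ω => (B ω, S ω, E ω)) = H μ (fun ω => (B ω, E ω)) :=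
    H_congr _ _ _ fun ω ω' => by simp only [Prod.mk.injEq, hf]; grind
  have e2 : H μ (fun ω => (B ω, A ω, S ω, E ω)) = H μ (fun ω => (B ω, A ω, E ω)) :=
    H_congr _ _ _ fun ω ω' => by simp only [Prod.mk.injEq, hf]; grind
  have e3 : H μ (fun ω => (S ω, E ω, A ω)) = H μ (fun ω => (A ω, S ω, E ω)) :=
    H_congr _ _ _ fun ω ω' => by simp only [Prod.mk.injEq]; tauto
  have e4 : H μ (fun ω => (E ω, A ω)) = H μ (fun ω => (A ω, E ω)) :=
    H_congr _ _ _ fun ω ω' => by simp only [Prod.mk.injEq]; tauto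
  rw [le_div_iff₀ (by linarith)]
  unfold CMI at *
  unfold condH at hrel
  unfold MI at hsec
  linarith
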